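/- Let (X,d) be a compact, K_D-doubling, K_P-uniformly perfect metric space with diam(X,d) = 1/2, equipped with a hyperbolic filling with parameters λ ≥ 32 and a ≥ 24·max(λ,K_P), and let β > 0. Let ρ : S → (0,1) satisfy (H1) and (H2), let C : S → (0,∞) be (K_h,K_v)-gentle, and assume ρ is (β,C)-compatible. Let θ be a metric on X quasisymmetric to d for which there exists K ≥ 1 with K^{-1}·π(B) ≤ diam(B,θ) ≤ K·π(B) for all B ∈ S. For n ≥ 0 set μ_n := Σ_{B ∈ S_n} π(B)^β·C(B)·δ_{x_B} and let μ be a subsequential weak-* limit of (μ_n). Then there exists C₁ > 1 such that for all x ∈ X and 0 < r < diam(X,θ): C₁^{-1}·r^β·C(B) ≤ μ(B_θ(x,r)) ≤ C₁·r^β·C(B) for every B ∈ A_S(B_d(x,s)), where s := sup{0 ≤ t < 2·diam(X,d) : B_d(x,t) ⊆ B_θ(x,r)} and B_θ, B_d denote open balls in the metrics θ and d respectively. -/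

import Mathlib

open Metric Set MeasureTheory Filter Topology
open scoped BigOperators ENNReal NNReal

noncomputable section

/-- A metric space `(X,d)` is `K`-doubling: every ball of radius `r` can be covered by at most
`K` balls of radius `r/2`. -/
def IsDoublingWith (X : Type*) [PseudoMetricSpace X] (K : ℝ) : Prop :=
  ∀ (x : X) (r : ℝ), 0 < r → ∃ t : Finset X, (t.card : ℝ) ≤ K ∧
    Metric.ball x r ⊆ ⋃ y ∈ t, Metric.ball y (r / 2)

/-- A metric space `(X,d)` is `K`-uniformly perfect: if `X ∖ B(x,r) ≠ ∅` then
`B(x,r) ∖ B(x,r/K) ≠ ∅`. -/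
def IsUniformlyPerfectWith (X : Type*) [PseudoMetricSpace X] (K : ℝ) : Prop :=
  ∀ (x : X) (r : ℝ), 0 < r → ((Metric.ball x r)ᶜ).Nonempty →
    (Metric.ball x r \ Metric.ball x (r / K)).Nonempty

/-- A hyperbolic filling of a compact metric space `(X,d)` (of diameter `1/2`) with vertical
parameter `a`: for each level `n`, a finite set `N n` of centers of balls of radius `2·a⁻ⁿ`
covering `X`, whose centers are `a⁻ⁿ`-separated, with `N 0` a singleton, together with a
parent assignment sending each center at level `n+1` to a nearest center at level `n`. -/
structure HypFilling (X : Type*) [MetricSpace X] (a : ℝ) where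
  N : ℕ → Finset X
  N0 : ∃ x₀ : X, N 0 = {x₀}
  sep : ∀ n : ℕ, ∀ x ∈ N n, ∀ y ∈ N n, x ≠ y → a ^ (-(n : ℤ)) ≤ dist x y
  cover : ∀ (n : ℕ) (y : X), ∃ x ∈ N n, dist y x < 2 * a ^ (-(n : ℤ))
  parent : ℕ → X → X
  parent_mem : ∀ n : ℕ, ∀ x ∈ N (n + 1), parent n x ∈ N n
  parent_nearest : ∀ n : ℕ, ∀ x ∈ N (n + 1), ∀ z ∈ N n, dist x (parent n x) ≤ dist x z

namespace HypFilling

variable {X : Type*} [MetricSpace X] {a : ℝ}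

/-- `anc F j n x` is the `j`-step ancestor (living at level `n - j`) of the vertex of the
filling with center `x` at level `n`; i.e. the genealogy of `(n,x)` is
`g(B)ᵢ = anc F (n-i) n x`. -/
def anc (F : HypFilling X a) : ℕ → ℕ → X → X
  | 0, _, x => x
  | j + 1, n, x => F.parent (n - (j + 1)) (anc F j n x)

/-- `π(B) = ∏_{i=0}^{n} ρ(g(B)ᵢ)` for a vertex `B = (n,x)` and weight function `ρ`. -/
def piW (F : HypFilling X a) (ρ : ℕ → X → ℝ) (n : ℕ) (x : X) : ℝ :=
  ∏ j ∈ Finset.range (n + 1), ρ (n - j) (anc F j n x)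

/-- `(n,x')` is a descendant of `(m,x)`, i.e. `x' ∈ D_n((m,x))`. -/
def Desc (F : HypFilling X a) (m : ℕ) (x : X) (n : ℕ) (x' : X) : Prop :=
  x' ∈ F.N n ∧ anc F (n - m) n x' = x

/-- Horizontal edge (with horizontal parameter `lam`) between the distinct level-`n` vertices
with centers `x` and `y`: the `lam`-dilates of the two balls intersect. -/
def Hor (F : HypFilling X a) (lam : ℝ) (n : ℕ) (x y : X) : Prop :=
  x ∈ F.N n ∧ y ∈ F.N n ∧ x ≠ y ∧
    (Metric.ball x (lam * (2 * a ^ (-(n : ℤ)))) ∩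
      Metric.ball y (lam * (2 * a ^ (-(n : ℤ))))).Nonempty

/-- Horizontal or vertical edge on the vertex set `⊔ₙ Sₙ` (a vertex is a pair (level, center)). -/
def Edge (F : HypFilling X a) (lam : ℝ) (v w : ℕ × X) : Prop :=
  (v.1 = w.1 ∧ F.Hor lam v.1 v.2 w.2) ∨
    (w.1 = v.1 + 1 ∧ w.2 ∈ F.N (v.1 + 1) ∧ F.parent v.1 w.2 = v.2) ∨
    (v.1 = w.1 + 1 ∧ v.2 ∈ F.N (w.1 + 1) ∧ F.parent w.1 v.2 = w.2)

/-- Condition (H1): the weight function is bounded between two constants `0 < η₋ ≤ η₊ < 1`. -/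
def H1 (F : HypFilling X a) (ρ : ℕ → X → ℝ) : Prop :=
  ∃ ηm ηp : ℝ, 0 < ηm ∧ ηm ≤ ηp ∧ ηp < 1 ∧
    ∀ n : ℕ, ∀ x ∈ F.N n, ηm ≤ ρ n x ∧ ρ n x ≤ ηp

/-- Condition (H2): `π` is comparable along horizontal edges. -/
def H2 (F : HypFilling X a) (lam : ℝ) (ρ : ℕ → X → ℝ) : Prop :=
  ∃ K₀ : ℝ, 1 ≤ K₀ ∧ ∀ (n : ℕ) (x y : X), F.Hor lam n x y →
    F.piW ρ n x ≤ K₀ * F.piW ρ n y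

/-- `z` is the center of a level-`j` vertex whose `α`-dilate contains both `x` and `y`. -/
def inC (F : HypFilling X a) (α : ℝ) (x y : X) (j : ℕ) (z : X) : Prop :=
  z ∈ F.N j ∧ dist x z < α * (2 * a ^ (-(j : ℤ))) ∧ dist y z < α * (2 * a ^ (-(j : ℤ)))

/-- `m_α(x,y)`: the maximal level `j` such that some level-`j` vertex has both `x` and `y`
in its `α`-dilate. -/
def mAlpha (F : HypFilling X a) (α : ℝ) (x y : X) : ℕ :=
  sSup {j : ℕ | ∃ z : X, F.inC α x y j z}

/-- `π(c_α(x,y))`: the maximum of `π` over the level-`m_α(x,y)` vertices whose `α`-dilates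
contain both `x` and `y`. -/
def piC (F : HypFilling X a) (ρ : ℕ → X → ℝ) (α : ℝ) (x y : X) : ℝ :=
  sSup ((fun z => F.piW ρ (F.mAlpha α x y) z) '' {z : X | F.inC α x y (F.mAlpha α x y) z})

/-- A path of vertices `p 0, …, p (k-1)` of the filling, joined consecutively by horizontal or
vertical edges, starting and ending at level `n`, from a ball containing `x` to a ball
containing `y`. -/
def IsPath (F : HypFilling X a) (lam : ℝ) (n k : ℕ) (p : ℕ → ℕ × X) (x y : X) : Prop :=
  1 ≤ k ∧ (∀ i < k, (p i).2 ∈ F.N (p i).1) ∧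
    (∀ i : ℕ, i + 1 < k → F.Edge lam (p i) (p (i + 1))) ∧
    (p 0).1 = n ∧ (p (k - 1)).1 = n ∧
    dist x (p 0).2 < 2 * a ^ (-(n : ℤ)) ∧ dist y (p (k - 1)).2 < 2 * a ^ (-(n : ℤ))

/-- Condition (H3) with visual parameter `α` and constant `K₁`. -/
def H3With (F : HypFilling X a) (lam : ℝ) (ρ : ℕ → X → ℝ) (α K₁ : ℝ) : Prop :=
  2 ≤ α ∧ α ≤ lam / 4 ∧ 1 ≤ K₁ ∧
    ∀ x y : X, x ≠ y → ∃ n₀ : ℕ, ∀ n : ℕ, n₀ ≤ n →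
      ∀ (k : ℕ) (p : ℕ → ℕ × X), F.IsPath lam n k p x y →
        K₁⁻¹ * F.piC ρ α x y ≤ ∑ i ∈ Finset.range k, F.piW ρ (p i).1 (p i).2

/-- Condition (H3). -/
def H3 (F : HypFilling X a) (lam : ℝ) (ρ : ℕ → X → ℝ) : Prop :=
  ∃ α K₁ : ℝ, F.H3With lam ρ α K₁

/-- `ρ` is `(β,C)`-compatible. -/
def Compatible (F : HypFilling X a) (β : ℝ) (C ρ : ℕ → X → ℝ) : Prop :=
  ∃ K₂ : ℝ, 1 ≤ K₂ ∧ ∀ m : ℕ, ∀ x ∈ F.N m, ∀ n : ℕ, m < n →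
    K₂⁻¹ * (F.piW ρ m x ^ β * C m x) ≤
        (∑ᶠ x' ∈ {x' : X | F.Desc m x n x'}, F.piW ρ n x' ^ β * C n x') ∧
      (∑ᶠ x' ∈ {x' : X | F.Desc m x n x'}, F.piW ρ n x' ^ β * C n x') ≤
        K₂ * (F.piW ρ m x ^ β * C m x)

/-- `C` is `(K_h,K_v)`-gentle: comparable (with constant `K_h`, resp. `K_v`) along horizontal,
resp. vertical, edges. -/
def Gentle (F : HypFilling X a) (lam Kh Kv : ℝ) (C : ℕ → X → ℝ) : Prop :=
  (∀ (n : ℕ) (x y : X), F.Hor lam n x y → C n x ≤ Kh * C n y) ∧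
    ∀ n : ℕ, ∀ x ∈ F.N (n + 1),
      C (n + 1) x ≤ Kv * C n (F.parent n x) ∧ C n (F.parent n x) ≤ Kv * C (n + 1) x

/-- The level-`(k+1)` vertex with center `x` is non-peripheral: all its horizontal neighbours
have the same parent. -/
def NonPeripheral (F : HypFilling X a) (lam : ℝ) (k : ℕ) (x : X) : Prop :=
  x ∈ F.N (k + 1) ∧ ∀ y : X, F.Hor lam (k + 1) x y → F.parent k y = F.parent k x

/-- Condition (E): enhanced subadditivity of `C` over non-peripheral children. -/
def CondE (F : HypFilling X a) (lam : ℝ) (C : ℕ → X → ℝ) : Prop :=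
  ∃ δ : ℝ, 0 < δ ∧ δ < 1 ∧ ∀ k : ℕ, 1 ≤ k → ∀ x ∈ F.N k,
    C k x ≤ (1 - δ) *
      ∑ᶠ x' ∈ {x' : X | F.parent k x' = x ∧ F.NonPeripheral lam k x'}, C (k + 1) x'

/-- The horizontal paths at level `k+1` crossing the annulus `2·B ∖ B` of a level-`k` ball `B`
with center `x`: the family `Γ_{k+1}(B)`. -/
def GammaPath (F : HypFilling X a) (lam : ℝ) (k : ℕ) (x : X) (m : ℕ) (p : ℕ → X) : Prop :=
  2 ≤ m ∧ (∀ i < m, p i ∈ F.N (k + 1)) ∧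
    (∀ i : ℕ, i + 1 < m → F.Hor lam (k + 1) (p i) (p (i + 1))) ∧
    dist (p 0) x < 2 * a ^ (-(k : ℤ)) ∧
    (∀ i < m - 1, dist (p i) x < 2 * (2 * a ^ (-(k : ℤ)))) ∧
    ¬ dist (p (m - 1)) x < 2 * (2 * a ^ (-(k : ℤ)))

/-- Condition (S1) for `σ`. -/
def S1 (F : HypFilling X a) (lam : ℝ) (σ : ℕ → X → ℝ) : Prop :=
  ∀ k : ℕ, ∀ x ∈ F.N k, ∀ (m : ℕ) (p : ℕ → X), F.GammaPath lam k x m p →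
    1 ≤ ∑ i ∈ Finset.range m, σ (k + 1) (p i)

/-- Condition (S2) for `σ` with constant `η₀`. -/
def S2 (F : HypFilling X a) (β η₀ : ℝ) (C σ : ℕ → X → ℝ) : Prop :=
  ∀ k : ℕ, ∀ x ∈ F.N k,
    (∑ᶠ x' ∈ {x' : X | x' ∈ F.N (k + 1) ∧ F.parent k x' = x},
        σ (k + 1) x' ^ β * C (k + 1) x') ≤ η₀ * C k x

end HypFilling

/-- `θ` is a metric (distance function) on `X`. -/
def IsMetricOn (X : Type*) (θ : X → X → ℝ) : Prop :=
  (∀ x y : X, 0 ≤ θ x y) ∧ (∀ x y : X, θ x y = 0 ↔ x = y) ∧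
    (∀ x y : X, θ x y = θ y x) ∧ ∀ x y z : X, θ x z ≤ θ x y + θ y z

/-- A distortion function: an increasing self-homeomorphism of `[0,∞)`. -/
def IsDistortion (η : ℝ → ℝ) : Prop :=
  StrictMonoOn η (Set.Ici 0) ∧ ContinuousOn η (Set.Ici 0) ∧ η '' Set.Ici 0 = Set.Ici 0

/-- `θ` is `η`-quasisymmetric to `d`: `θ(x,u)/θ(x,v) ≤ η(d(x,u)/d(x,v))` whenever `x ≠ v`. -/
def QuasisymmetricWith {X : Type*} (η : ℝ → ℝ) (d θ : X → X → ℝ) : Prop :=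
  ∀ x u v : X, x ≠ v → θ x u ≤ η (d x u / d x v) * θ x v

/-- Diameter of a set with respect to a distance function. -/
noncomputable def diamWith {X : Type*} (θ : X → X → ℝ) (A : Set X) : ℝ :=
  sSup (Set.image2 θ A A)

/-- Open ball with respect to a distance function. -/
def mball {X : Type*} (θ : X → X → ℝ) (x : X) (r : ℝ) : Set X := {y | θ x y < r}

/-- The discrete approximating measures `μₙ := Σ_{B ∈ Sₙ} π(B)^β C(B) δ_{x_B}`. -/
noncomputable def seqMeas {X : Type*} [MetricSpace X] [MeasurableSpace X] {a : ℝ}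
    (F : HypFilling X a) (ρ C : ℕ → X → ℝ) (β : ℝ) (n : ℕ) : Measure X :=
  ∑ x ∈ F.N n, ENNReal.ofReal (F.piW ρ n x ^ β * C n x) • MeasureTheory.Measure.dirac x


section helpers
open Classical

variable {X : Type} [MetricSpace X] {a : ℝ}

/-- A continuous bump: one on the `R`-ball, zero off the `2R`-ball. -/
def bump (x : X) (R : ℝ) (y : X) : ℝ := max 0 (min 1 (2 - dist x y / R))

lemma bump_cont (x : X) (R : ℝ) : Continuous (bump x R) := by
  unfold bump
  fun_prop

lemma bump_nonneg (x : X) (R : ℝ) (y : X) : 0 ≤ bump x R y := le_max_left _ _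

lemma bump_le_one (x : X) (R : ℝ) (y : X) : bump x R y ≤ 1 :=
  max_le zero_le_one (min_le_left _ _)

lemma bump_eq_one {x : X} {R : ℝ} {y : X} (hR : 0 < R) (h : dist x y ≤ R) : bump x R y = 1 := by
  have : dist x y / R ≤ 1 := by rwa [div_le_one hR]
  unfold bump
  rw [min_eq_left (by linarith), max_eq_right zero_le_one]

lemma bump_eq_zero {x : X} {R : ℝ} {y : X} (hR : 0 < R) (h : 2 * R ≤ dist x y) :
    bump x R y = 0 := by
  have : 2 ≤ dist x y / R := by rwa [le_div_iff₀ hR]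
  unfold bump
  rw [max_eq_left]
  exact (min_le_right _ _).trans (by linarith)

lemma card_sep {KD : ℝ} (hKD : 1 ≤ KD) (hd : IsDoublingWith X KD) {δ : ℝ} (j : ℕ) :
    ∀ (A : Finset X) (x : X) (R : ℝ), 0 < R → R ≤ 2 ^ j * (δ / 2) →
      (∀ u ∈ A, ∀ v ∈ A, u ≠ v → δ ≤ dist u v) → (∀ u ∈ A, u ∈ Metric.ball x R) →
      (A.card : ℝ) ≤ KD ^ j := by
  induction j with
  | zero =>
    intro A x R hR hRd hs hA
    have : A.card ≤ 1 := by
      rw [Finset.card_le_one]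
      intro u hu v hv
      by_contra hne
      have h1 := hs u hu v hv hne
      have h2 := hA u hu
      have h3 := hA v hv
      rw [Metric.mem_ball] at h2 h3
      have := dist_triangle_right u v x
      simp at hRd
      linarith
    simpa using this
  | succ j ih =>
    intro A x R hR hRd hs hA
    obtain ⟨t, ht, hcov⟩ := hd x R hR
    have hsub : A ⊆ t.biUnion (fun y => A.filter (fun u => u ∈ Metric.ball y (R / 2))) := by
      intro u hu
      have := hcov (hA u hu)
      simp only [Set.mem_iUnion] at this
      obtain ⟨y, hy, huy⟩ := this
      rw [Finset.mem_biUnion]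
      exact ⟨y, hy, by simp [hu]; simpa using huy⟩
    have h1 : (A.card : ℝ) ≤ ∑ y ∈ t, ((A.filter (fun u => u ∈ Metric.ball y (R / 2))).card : ℝ) := by
      exact_mod_cast (Finset.card_le_card hsub).trans Finset.card_biUnion_le
    have h2 : ∀ y ∈ t, ((A.filter (fun u => u ∈ Metric.ball y (R / 2))).card : ℝ) ≤ KD ^ j := by
      intro y _
      apply ih _ y (R / 2) (by linarith)
      · rw [pow_succ] at hRd; linarith
      · intro u hu v hv
        exact hs u (Finset.mem_filter.1 hu).1 v (Finset.mem_filter.1 hv).1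
      · intro u hu
        exact (Finset.mem_filter.1 hu).2
    have h3 := Finset.sum_le_card_nsmul t _ _ h2
    rw [nsmul_eq_mul] at h3
    have : (t.card : ℝ) * KD ^ j ≤ KD * KD ^ j :=
      mul_le_mul_of_nonneg_right ht (by positivity)
    rw [pow_succ']
    linarith

lemma zp_succ (ha : 0 < a) (n : ℕ) : a ^ (-((n + 1 : ℕ) : ℤ)) * a = a ^ (-(n : ℤ)) := by
  have : (-(n : ℤ)) = -((n + 1 : ℕ) : ℤ) + 1 := by push_cast; ring
  rw [this, zpow_add_one₀ ha.ne']

lemma anc_succ' (F : HypFilling X a) (j k : ℕ) (x : X) :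
    F.anc (j + 1) (k + 1) x = F.anc j k (F.parent k x) := by
  induction j with
  | zero => simp [HypFilling.anc]
  | succ j ih =>
    rw [HypFilling.anc, ih, HypFilling.anc, Nat.succ_sub_succ]

lemma piW_succ (F : HypFilling X a) (ρ : ℕ → X → ℝ) (k : ℕ) (x : X) :
    F.piW ρ (k + 1) x = ρ (k + 1) x * F.piW ρ k (F.parent k x) := by
  unfold HypFilling.piW
  rw [Finset.prod_range_succ', mul_comm]
  congr 1
  apply Finset.prod_congr rfl
  intro j _
  rw [anc_succ', Nat.succ_sub_succ]

lemma anc_mem_dist (F : HypFilling X a) (ha : 2 ≤ a) (k : ℕ) (x : X) (hx : x ∈ F.N k) (j : ℕ) :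
    j ≤ k → F.anc j k x ∈ F.N (k - j) ∧ dist x (F.anc j k x) ≤ 4 * a ^ (-((k - j : ℕ) : ℤ)) := by
  have ha0 : 0 < a := by linarith
  induction j with
  | zero =>
    intro _
    refine ⟨by simpa [HypFilling.anc] using hx, ?_⟩
    simp only [HypFilling.anc, dist_self]
    positivity
  | succ j ih =>
    intro hj
    obtain ⟨hm, hd⟩ := ih (by omega)
    obtain ⟨q, hq⟩ : ∃ q, q = k - (j + 1) := ⟨_, rfl⟩
    have hq' : k - j = q + 1 := by omega
    rw [hq'] at hm hd
    rw [HypFilling.anc, ← hq]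
    refine ⟨F.parent_mem q _ hm, ?_⟩
    obtain ⟨y, hy, hyd⟩ := F.cover q (F.anc j k x)
    have h1 := F.parent_nearest q _ hm y hy
    have h2 := dist_triangle x (F.anc j k x) (F.parent q (F.anc j k x))
    have h3 := zp_succ ha0 q
    have h4 : 0 < a ^ (-((q + 1 : ℕ) : ℤ)) := by positivity
    nlinarith

lemma anc_est (F : HypFilling X a) {ρ C : ℕ → X → ℝ} {ηm Kv : ℝ} (hη : 0 < ηm)
    (hηρ : ∀ n : ℕ, ∀ x ∈ F.N n, ηm ≤ ρ n x) (hKv : 1 ≤ Kv) (ha : 2 ≤ a)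
    (hpi : ∀ n : ℕ, ∀ x ∈ F.N n, 0 < F.piW ρ n x)
    (hC : ∀ n : ℕ, ∀ x ∈ F.N (n + 1),
      C (n + 1) x ≤ Kv * C n (F.parent n x) ∧ C n (F.parent n x) ≤ Kv * C (n + 1) x)
    (k : ℕ) (x : X) (hx : x ∈ F.N k) (j : ℕ) :
    j ≤ k → ηm ^ j * F.piW ρ (k - j) (F.anc j k x) ≤ F.piW ρ k x ∧
      C (k - j) (F.anc j k x) ≤ Kv ^ j * C k x := by
  induction j with
  | zero => intro _; simp [HypFilling.anc]
  | succ j ih =>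
    intro hj
    obtain ⟨h1, h2⟩ := ih (by omega)
    obtain ⟨hm, -⟩ := anc_mem_dist F ha k x hx j (by omega)
    obtain ⟨q, hq⟩ : ∃ q, q = k - (j + 1) := ⟨_, rfl⟩
    have hq' : k - j = q + 1 := by omega
    rw [hq'] at hm h1 h2
    rw [HypFilling.anc, ← hq]
    rw [piW_succ] at h1
    have h3 := (hC q _ hm).2
    have h4 := hηρ _ _ hm
    have h5 := hpi q _ (F.parent_mem q _ hm)
    constructor
    · refine le_trans ?_ h1
      rw [pow_succ, mul_assoc]
      gcongr
    · refine h3.trans ?_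
      rw [pow_succ', mul_assoc]
      gcongr

lemma piW_pos (F : HypFilling X a) {ρ : ℕ → X → ℝ} (hρ : ∀ n : ℕ, ∀ x ∈ F.N n, 0 < ρ n x) (n : ℕ) :
    ∀ x ∈ F.N n, 0 < F.piW ρ n x := by
  induction n with
  | zero => intro x hx; simpa [HypFilling.piW, HypFilling.anc] using hρ 0 x hx
  | succ n ih =>
    intro x hx
    rw [piW_succ]
    exact mul_pos (hρ _ x hx) (ih _ (F.parent_mem n x hx))

lemma hor_of_dist (F : HypFilling X a) {lam : ℝ} (ha : 0 < a) (hlam : 32 ≤ lam) {n : ℕ} {x y : X}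
    (hx : x ∈ F.N n) (hy : y ∈ F.N n) (hne : x ≠ y) (h : dist x y < 20 * a ^ (-(n : ℤ))) :
    F.Hor lam n x y := by
  have h0 : 0 < a ^ (-(n : ℤ)) := by positivity
  refine ⟨hx, hy, hne, x, ?_, ?_⟩
  · apply Metric.mem_ball_self; positivity
  · rw [Metric.mem_ball]; nlinarith

lemma desc_sum (F : HypFilling X a) (m : ℕ) (x : X) (n : ℕ) (f : X → ℝ) :
    (∑ᶠ x' ∈ {x' : X | F.Desc m x n x'}, f x') =
      ∑ x' ∈ (F.N n).filter (fun x' => F.anc (n - m) n x' = x), f x' := by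
  have h : {x' : X | F.Desc m x n x'} =
      ↑((F.N n).filter (fun x' => F.anc (n - m) n x' = x)) := by
    ext y
    simp [HypFilling.Desc]
  rw [h, finsum_mem_coe_finset]

lemma integral_seqMeas [MeasurableSpace X] [BorelSpace X] (F : HypFilling X a)
    (ρ C : ℕ → X → ℝ) (β : ℝ) (n : ℕ)
    (hw : ∀ x ∈ F.N n, 0 ≤ F.piW ρ n x ^ β * C n x) (f : X → ℝ) :
    ∫ z, f z ∂ seqMeas F ρ C β n = ∑ x ∈ F.N n, (F.piW ρ n x ^ β * C n x) * f x := by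
  unfold seqMeas
  rw [integral_finsetSum_measure]
  · apply Finset.sum_congr rfl
    intro x hx
    rw [integral_smul_measure, integral_dirac, ENNReal.toReal_ofReal (hw x hx), smul_eq_mul]
  · intro x hx
    apply Integrable.smul_measure _ ENNReal.ofReal_ne_top
    exact integrable_dirac (by simp)

lemma mu_lower [CompactSpace X] [MeasurableSpace X] [BorelSpace X] (μ : Measure X) [IsFiniteMeasure μ]
    (x : X) {R : ℝ} (hR : 0 < R) {c : ℝ} (h : c ≤ ∫ z, bump x R z ∂μ) :
    ENNReal.ofReal c ≤ μ (Metric.ball x (2 * R)) := by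
  have hint : Integrable (bump x R) μ :=
    (bump_cont x R).integrable_of_hasCompactSupport (HasCompactSupport.of_compactSpace _)
  have h2 : ∫ z, bump x R z ∂μ ≤ ∫ z, (Metric.ball x (2 * R)).indicator (fun _ => (1 : ℝ)) z ∂μ := by
    apply integral_mono hint
    · exact (integrable_const (1 : ℝ)).indicator Metric.isOpen_ball.measurableSet
    · intro z
      by_cases hz : z ∈ Metric.ball x (2 * R)
      · simp only [Set.indicator_of_mem hz]; exact bump_le_one _ _ _
      · simp only [Set.indicator_of_notMem hz]
        rw [Metric.mem_ball, not_lt, dist_comm] at hz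
        exact (bump_eq_zero hR hz).le
  rw [integral_indicator_const _ Metric.isOpen_ball.measurableSet, smul_eq_mul, mul_one] at h2
  exact ENNReal.ofReal_le_of_le_toReal (h.trans h2)

lemma mu_upper [CompactSpace X] [MeasurableSpace X] [BorelSpace X] (μ : Measure X) [IsFiniteMeasure μ]
    (x : X) {R : ℝ} (hR : 0 < R) {c : ℝ} (h : ∫ z, bump x R z ∂μ ≤ c) :
    μ (Metric.ball x R) ≤ ENNReal.ofReal c := by
  have hint : Integrable (bump x R) μ :=
    (bump_cont x R).integrable_of_hasCompactSupport (HasCompactSupport.of_compactSpace _)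
  have h2 : ∫ z, (Metric.ball x R).indicator (fun _ => (1 : ℝ)) z ∂μ ≤ ∫ z, bump x R z ∂μ := by
    apply integral_mono _ hint
    · intro z
      by_cases hz : z ∈ Metric.ball x R
      · simp only [Set.indicator_of_mem hz]
        rw [Metric.mem_ball, dist_comm] at hz
        exact (bump_eq_one hR hz.le).ge
      · simp only [Set.indicator_of_notMem hz]; exact bump_nonneg _ _ _
    · exact (integrable_const (1 : ℝ)).indicator Metric.isOpen_ball.measurableSet
  rw [integral_indicator_const _ Metric.isOpen_ball.measurableSet, smul_eq_mul, mul_one] at h2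
  rw [← ENNReal.ofReal_toReal (measure_ne_top μ (Metric.ball x R))]
  exact ENNReal.ofReal_le_ofReal (h2.trans h)

end helpers

set_option maxHeartbeats 4000000 in
/-- Proposition 3.8: if moreover `θ ∈ J(X,d)` satisfies
`K⁻¹ π(B) ≤ diam(B,θ) ≤ K π(B)`, then any weak-* subsequential limit `μ` of the `μₙ`
satisfies `C₁⁻¹ r^β C(B) ≤ μ(B_θ(x,r)) ≤ C₁ r^β C(B)` for `0 < r < diam(X,θ)` and
`B ∈ A_S(B_d(x,s))`, where `s` is the largest `0 ≤ s < 2 diam(X,d)` with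
`B_d(x,s) ⊆ B_θ(x,r)`. -/
theorem measure_estimate_in_new_metric
    (X : Type) [MetricSpace X] [CompactSpace X] [MeasurableSpace X] [BorelSpace X]
    (KD KP lam a β Kh Kv : ℝ) (η : ℝ → ℝ) (θ : X → X → ℝ)
    (F : HypFilling X a) (ρ C : ℕ → X → ℝ) (μ : Measure X)
    (hKD : 1 ≤ KD) (hKP : 1 < KP) (hlam : 32 ≤ lam) (ha : 24 * max lam KP ≤ a)
    (hβ : 0 < β) (hKh : 1 ≤ Kh) (hKv : 1 ≤ Kv)
    (hdiam : Metric.diam (Set.univ : Set X) = 1 / 2)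
    (hdoub : IsDoublingWith X KD) (hperf : IsUniformlyPerfectWith X KP)
    (hρ : ∀ n : ℕ, ∀ x ∈ F.N n, 0 < ρ n x ∧ ρ n x < 1)
    (h1 : F.H1 ρ) (h2 : F.H2 lam ρ)
    (hC : ∀ n : ℕ, ∀ x ∈ F.N n, 0 < C n x)
    (hgentle : F.Gentle lam Kh Kv C)
    (hcomp : F.Compatible β C ρ)
    (hθ : IsMetricOn X θ) (hdist : IsDistortion η)
    (hqs : QuasisymmetricWith η (fun x y : X => dist x y) θ)
    (hKdiam : ∃ K : ℝ, 1 ≤ K ∧ ∀ n : ℕ, ∀ x ∈ F.N n,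
      K⁻¹ * F.piW ρ n x ≤ diamWith θ (Metric.ball x (2 * a ^ (-(n : ℤ)))) ∧
        diamWith θ (Metric.ball x (2 * a ^ (-(n : ℤ)))) ≤ K * F.piW ρ n x)
    (hμ : ∃ φ : ℕ → ℕ, StrictMono φ ∧ ∀ f : X → ℝ, Continuous f →
      Filter.Tendsto (fun j => ∫ z, f z ∂ seqMeas F ρ C β (φ j)) Filter.atTop
        (nhds (∫ z, f z ∂ μ))) :
    ∃ C₁ : ℝ, 1 < C₁ ∧ ∀ (x : X) (r : ℝ), 0 < r → r < diamWith θ (Set.univ : Set X) →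
      ∀ s : ℝ, s = sSup {t : ℝ | 0 ≤ t ∧ t < 2 * Metric.diam (Set.univ : Set X) ∧
          Metric.ball x t ⊆ mball θ x r} →
        ∀ (n : ℕ) (z : X), z ∈ F.N n →
          2 * a ^ (-((n : ℤ) + 1)) ≤ s → s < 2 * a ^ (-(n : ℤ)) →
          dist z x < 2 * a ^ (-(n : ℤ)) →
          ENNReal.ofReal (C₁⁻¹ * (r ^ β * C n z)) ≤ μ (mball θ x r) ∧
            μ (mball θ x r) ≤ ENNReal.ofReal (C₁ * (r ^ β * C n z)) := by
  classical
  have ha24 : 24 * lam ≤ a := le_trans (by have := le_max_left lam KP; linarith) ha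
  have ha768 : 768 ≤ a := by linarith
  have ha0 : 0 < a := by linarith
  have ha2 : 2 ≤ a := by linarith
  have hE0 : ∀ n : ℕ, 0 < a ^ (-(n : ℤ)) := fun n => by positivity
  have hEs : ∀ n : ℕ, a ^ (-((n + 1 : ℕ) : ℤ)) * a = a ^ (-(n : ℤ)) := zp_succ ha0
  have hEle : ∀ m n : ℕ, m ≤ n → a ^ (-(n : ℤ)) ≤ a ^ (-(m : ℤ)) := by
    intro m n hmn
    apply zpow_le_zpow_right₀ (by linarith)
    simpa using hmn
  have hE768 : ∀ n : ℕ, 1 ≤ n → a ^ (-(n : ℤ)) ≤ 1 / 768 := by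
    intro n hn
    refine (hEle 1 n hn).trans ?_
    have : a ^ (-((1 : ℕ) : ℤ)) = 1 / a := by simp
    rw [this]
    exact one_div_le_one_div_of_le (by norm_num) ha768
  obtain ⟨ηm, ηp, hηm, hηmp, hηp, hη⟩ := h1
  obtain ⟨K₀, hK₀, hH2⟩ := h2
  obtain ⟨K₂, hK₂, hcomp⟩ := hcomp
  obtain ⟨K, hK, hKd⟩ := hKdiam
  obtain ⟨φ, hφ, hlim⟩ := hμ
  obtain ⟨hCh, hCv⟩ := hgentle
  obtain ⟨hθ0, hθeq, hθs, hθt⟩ := hθ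
  obtain ⟨hηmono, -, hηim⟩ := hdist
  have hηmono' := hηmono.monotoneOn
  have hpi : ∀ n : ℕ, ∀ x ∈ F.N n, 0 < F.piW ρ n x :=
    piW_pos F (fun n x hx => (hρ n x hx).1)
  have hηρ : ∀ n : ℕ, ∀ x ∈ F.N n, ηm ≤ ρ n x := fun n x hx => (hη n x hx).1
  have hηm1 : ηm < 1 := by linarith
  have hw : ∀ n : ℕ, ∀ x ∈ F.N n, 0 < F.piW ρ n x ^ β * C n x := fun n x hx =>
    mul_pos (Real.rpow_pos_of_pos (hpi n x hx) _) (hC n x hx)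
  have hdist : ∀ x y : X, dist x y ≤ 1 / 2 := by
    intro x y
    rw [← hdiam]
    exact Metric.dist_le_diam_of_mem isCompact_univ.isBounded (mem_univ _) (mem_univ _)
  -- horizontal comparability including equality
  have hhor : ∀ (n : ℕ) (x y : X), x ∈ F.N n → y ∈ F.N n → dist x y < 20 * a ^ (-(n : ℤ)) →
      F.piW ρ n x ≤ K₀ * F.piW ρ n y ∧ C n x ≤ Kh * C n y := by
    intro n x y hx hy hxy
    by_cases hne : x = y
    · subst hne
      exact ⟨le_mul_of_one_le_left (hpi n x hx).le hK₀, le_mul_of_one_le_left (hC n x hx).le hKh⟩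
    · have := hor_of_dist F ha0 hlam hx hy hne hxy
      exact ⟨hH2 n x y this, hCh n x y this⟩
  -- integrals against the approximating measures
  have hint : ∀ n : ℕ, ∀ f : X → ℝ, ∫ z, f z ∂ seqMeas F ρ C β n =
      ∑ x ∈ F.N n, (F.piW ρ n x ^ β * C n x) * f x := fun n f =>
    integral_seqMeas F ρ C β n (fun x hx => (hw n x hx).le) f
  -- a limit of lower bounds / upper bounds
  have hlow : ∀ (f : X → ℝ) (c : ℝ) (m : ℕ), Continuous f →
      (∀ k, m < k → c ≤ ∑ x ∈ F.N k, (F.piW ρ k x ^ β * C k x) * f x) → c ≤ ∫ z, f z ∂μ := by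
    intro f c m hf h
    refine ge_of_tendsto (hlim f hf) ?_
    filter_upwards [eventually_gt_atTop m] with j hj
    rw [hint]
    exact h _ (lt_of_lt_of_le hj (hφ.id_le j))
  have hupp : ∀ (f : X → ℝ) (c : ℝ) (m : ℕ), Continuous f →
      (∀ k, m < k → ∑ x ∈ F.N k, (F.piW ρ k x ^ β * C k x) * f x ≤ c) → ∫ z, f z ∂μ ≤ c := by
    intro f c m hf h
    refine le_of_tendsto (hlim f hf) ?_
    filter_upwards [eventually_gt_atTop m] with j hj
    rw [hint]
    exact h _ (lt_of_lt_of_le hj (hφ.id_le j))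
  -- descendant sums
  have hdesc : ∀ m : ℕ, ∀ x ∈ F.N m, ∀ k : ℕ, m < k →
      K₂⁻¹ * (F.piW ρ m x ^ β * C m x) ≤
        ∑ y ∈ (F.N k).filter (fun y => F.anc (k - m) k y = x), F.piW ρ k y ^ β * C k y ∧
      ∑ y ∈ (F.N k).filter (fun y => F.anc (k - m) k y = x), F.piW ρ k y ^ β * C k y ≤
        K₂ * (F.piW ρ m x ^ β * C m x) := by
    intro m x hx k hk
    have := hcomp m x hx k hk
    rwa [desc_sum] at this
  -- finiteness of the limit measure
  have hfin : IsFiniteMeasure μ := by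
    obtain ⟨x₀, hx₀⟩ := F.N0
    have hx₀' : x₀ ∈ F.N 0 := by simp [hx₀]
    have hle := hlow (fun _ => 1) (K₂⁻¹ * (F.piW ρ 0 x₀ ^ β * C 0 x₀)) 0 continuous_const (by
      intro k hk
      refine (hdesc 0 x₀ hx₀' k hk).1.trans ?_
      simp only [mul_one]
      exact Finset.sum_le_sum_of_subset_of_nonneg (Finset.filter_subset _ _)
        (fun y hy _ => (hw k y hy).le))
    have hpos : 0 < K₂⁻¹ * (F.piW ρ 0 x₀ ^ β * C 0 x₀) :=
      mul_pos (by positivity) (hw 0 x₀ hx₀')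
    constructor
    by_contra htop
    rw [not_lt, top_le_iff] at htop
    simp only [integral_const, Measure.real, htop, ENNReal.toReal_top, zero_smul] at hle
    linarith
  -- boundedness of θ
  obtain ⟨p0, q0, hpq⟩ : ∃ p q : X, p ≠ q := by
    by_contra hcon
    push Not at hcon
    have : Metric.diam (Set.univ : Set X) ≤ 0 :=
      Metric.diam_le_of_forall_dist_le le_rfl (fun x _ y _ => by rw [hcon x y, dist_self])
    linarith
  obtain ⟨T, hT⟩ : ∃ T, ∀ u v, θ u v ≤ T := by
    have hb : ∀ u, θ p0 u ≤ η (1 / 2 / dist p0 q0) * θ p0 q0 := by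
      intro u
      refine (hqs p0 u q0 hpq).trans ?_
      apply mul_le_mul_of_nonneg_right _ (hθ0 _ _)
      apply hηmono'
      · exact div_nonneg dist_nonneg dist_nonneg
      · exact div_nonneg (by norm_num) dist_nonneg
      · exact div_le_div_of_nonneg_right (hdist _ _) dist_nonneg
    refine ⟨2 * (η (1 / 2 / dist p0 q0) * θ p0 q0), fun u v => ?_⟩
    have h3 := hθt u p0 v
    rw [hθs u p0] at h3
    linarith [hb u, hb v]
  have hdiamle : ∀ (A : Set X) (u v : X), u ∈ A → v ∈ A → θ u v ≤ diamWith θ A := by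
    intro A u v hu hv
    apply le_csSup
    · refine ⟨T, ?_⟩
      rintro _ ⟨u', _, v', _, rfl⟩
      exact hT u' v'
    · exact ⟨u, hu, v, hv, rfl⟩
  -- constants from η
  obtain ⟨c, hc, hηc⟩ : ∃ c, 0 < c ∧ η c = 1 := by
    obtain ⟨c, hc, hc1⟩ : (1 : ℝ) ∈ η '' Ici 0 := by rw [hηim]; simp
    obtain ⟨u, hu, hu0⟩ : (0 : ℝ) ∈ η '' Ici 0 := by rw [hηim]; simp
    refine ⟨c, lt_of_le_of_ne hc ?_, hc1⟩
    rintro rfl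
    have := hηmono' hc hu hu
    linarith
  have hη4 : 0 ≤ η (4 * KP) := by
    have : η (4 * KP) ∈ η '' Ici 0 := ⟨_, by simp; linarith, rfl⟩
    rw [hηim] at this
    exact this
  obtain ⟨l, hl⟩ : ∃ l : ℕ, 4 / c < a ^ l := pow_unbounded_of_one_lt _ (by linarith)
  obtain ⟨A, hA⟩ : ∃ A, A = K * (1 + η (4 * KP)) := ⟨_, rfl⟩
  have hA0 : 0 < A := by rw [hA]; positivity
  obtain ⟨A', hA'⟩ : ∃ A', A' = 2 * K * K₀ / ηm ^ 2 := ⟨_, rfl⟩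
  have hA'0 : 0 < A' := by rw [hA']; positivity
  obtain ⟨L, hL⟩ : ∃ L, L = K₂⁻¹ * ((ηm ^ 2 / (K₀ * A)) ^ β * (1 / (Kv ^ 2 * Kh))) := ⟨_, rfl⟩
  have hL0 : 0 < L := by rw [hL]; positivity
  obtain ⟨U, hU⟩ : ∃ U, U = KD ^ 4 * (K₂ * ((K₀ * (A' / ηm ^ l)) ^ β * (Kh * Kv ^ l))) := ⟨_, rfl⟩
  have hU0 : 0 < U := by rw [hU]; positivity
  refine ⟨1 + L⁻¹ + U, by have := inv_pos.2 hL0; linarith, ?_⟩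
  intro x r hr hrd s hs n z hz hs1 hs2 hzx
  have hs1' : 2 * a ^ (-((n + 1 : ℕ) : ℤ)) ≤ s := by exact_mod_cast hs1
  have hE1 := hE0 (n + 1)
  have hs0 : 0 < s := by linarith
  rw [hdiam] at hs
  have hbdd : BddAbove {t : ℝ | 0 ≤ t ∧ t < 2 * (1 / 2) ∧ Metric.ball x t ⊆ mball θ x r} :=
    ⟨1, fun t ht => by have := ht.2.1; linarith⟩
  have hballs : Metric.ball x s ⊆ mball θ x r := by
    intro y hy
    rw [Metric.mem_ball, hs] at hy
    obtain ⟨t, ht, hyt⟩ := exists_lt_of_lt_csSup (show Set.Nonempty {t : ℝ | 0 ≤ t ∧ t < 2 * (1 / 2) ∧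
        Metric.ball x t ⊆ mball θ x r} from ⟨0, le_rfl, by norm_num, by simp⟩) hy
    exact ht.2.2 hyt
  -- a point just outside
  have hout : 1 ≤ n → ∃ y, dist x y < 2 * s ∧ r ≤ θ x y := by
    intro hn
    have h5 := hE768 n hn
    have hnot : ¬ Metric.ball x (2 * s) ⊆ mball θ x r := by
      intro hsub
      have : 2 * s ≤ s := by
        conv_rhs => rw [hs]
        exact le_csSup hbdd ⟨by linarith, by linarith, hsub⟩
      linarith
    rw [Set.not_subset] at hnot
    obtain ⟨y, hy, hy2⟩ := hnot
    refine ⟨y, by rwa [Metric.mem_ball, dist_comm] at hy, ?_⟩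
    simpa [mball] using hy2
  -- comparability of r and π(B)
  have hrA : r ≤ A * F.piW ρ n z := by
    have hd := (hKd n z hz).2
    have hπ := hpi n z hz
    rcases Nat.eq_zero_or_pos n with hn | hn
    · subst hn
      have hu : Metric.ball z (2 * a ^ (-((0 : ℕ) : ℤ))) = Set.univ := by
        ext y
        simp only [Metric.mem_ball, Set.mem_univ, iff_true, Nat.cast_zero, neg_zero, zpow_zero]
        linarith [hdist y z]
      rw [hu] at hd
      have : 0 ≤ K * η (4 * KP) * F.piW ρ 0 z := by positivity
      have hexp : A * F.piW ρ 0 z = K * F.piW ρ 0 z + K * η (4 * KP) * F.piW ρ 0 z := by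
        rw [hA]; ring
      linarith
    · obtain ⟨y, hy, hry⟩ := hout hn
      have hEn := hE0 n
      have h5 := hE768 n hn
      have hcompl : ((Metric.ball z (2 * a ^ (-(n : ℤ))))ᶜ).Nonempty := by
        by_contra hcon
        rw [Set.not_nonempty_iff_eq_empty, Set.compl_empty_iff] at hcon
        have hmem : ∀ u : X, dist u z < 2 * a ^ (-(n : ℤ)) := by
          intro u
          have : u ∈ Metric.ball z (2 * a ^ (-(n : ℤ))) := by rw [hcon]; trivial
          exact this
        have : Metric.diam (Set.univ : Set X) ≤ 1 / 4 := by
          apply Metric.diam_le_of_forall_dist_le (by norm_num)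
          intro u _ v _
          have := dist_triangle_right u v z
          linarith [hmem u, hmem v]
        linarith
      obtain ⟨v, hv1, hv2⟩ := hperf z _ (by positivity) hcompl
      rw [Metric.mem_ball, not_lt] at hv2
      obtain ⟨v', hv'1, hv'2⟩ : ∃ v' ∈ Metric.ball z (2 * a ^ (-(n : ℤ))),
          a ^ (-(n : ℤ)) / KP ≤ dist x v' := by
        by_cases hxv : a ^ (-(n : ℤ)) / KP ≤ dist x v
        · exact ⟨v, hv1, hxv⟩
        · refine ⟨z, Metric.mem_ball_self (by positivity), ?_⟩
          have := dist_triangle_left v z x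
          have h6 : 2 * a ^ (-(n : ℤ)) / KP = 2 * (a ^ (-(n : ℤ)) / KP) := by ring
          rw [h6] at hv2
          linarith
      have hpos : 0 < a ^ (-(n : ℤ)) / KP := by positivity
      have hv'0 : 0 < dist x v' := by linarith
      have h6 := hqs x y v' (dist_pos.1 hv'0)
      have h7 : η (dist x y / dist x v') ≤ η (4 * KP) := by
        apply hηmono'
        · exact div_nonneg dist_nonneg dist_nonneg
        · simp only [Set.mem_Ici]; linarith
        · rw [div_le_iff₀ hv'0]
          have h8 : 4 * KP * (a ^ (-(n : ℤ)) / KP) = 4 * a ^ (-(n : ℤ)) := by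
            field_simp
          have h9 : 4 * KP * (a ^ (-(n : ℤ)) / KP) ≤ 4 * KP * dist x v' := by
            gcongr
          linarith
      have h8 : θ x v' ≤ K * F.piW ρ n z :=
        (hdiamle _ x v' (by rwa [Metric.mem_ball, dist_comm]) hv'1).trans hd
      have h9 : θ x y ≤ η (4 * KP) * (K * F.piW ρ n z) := by
        refine h6.trans ?_
        exact mul_le_mul h7 h8 (hθ0 _ _) hη4
      have : 0 < K * F.piW ρ n z := by positivity
      have hexp : A * F.piW ρ n z = K * F.piW ρ n z + η (4 * KP) * (K * F.piW ρ n z) := by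
        rw [hA]; ring
      linarith
  -- a small ball inside
  obtain ⟨w, hwN, hwx⟩ := F.cover (n + 2) x
  have hE2 := hE0 (n + 2)
  have hE21 : a ^ (-((n + 2 : ℕ) : ℤ)) * a = a ^ (-((n + 1 : ℕ) : ℤ)) := hEs (n + 1)
  have hE10 := hEs n
  have hE768' : 768 * a ^ (-((n + 2 : ℕ) : ℤ)) ≤ a ^ (-((n + 1 : ℕ) : ℤ)) := by
    rw [← hE21, mul_comm]
    gcongr
  obtain ⟨hgN, hgd⟩ := anc_mem_dist F ha2 (n + 2) w hwN 2 (by omega)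
  obtain ⟨hgπ, hgC⟩ := anc_est F hηm hηρ hKv ha2 hpi hCv (n + 2) w hwN 2 (by omega)
  simp only [Nat.add_sub_cancel] at hgN hgd hgπ hgC
  obtain ⟨g, hg⟩ : ∃ g, g = F.anc 2 (n + 2) w := ⟨_, rfl⟩
  rw [← hg] at hgN hgd hgπ hgC
  have hzg : dist z g < 20 * a ^ (-(n : ℤ)) := by
    have h3 := dist_triangle4 z x w g
    have h4 := hEle n (n + 2) (by omega)
    have := hE0 n
    linarith
  obtain ⟨hzgπ, hzgC⟩ := hhor n z g hz hgN hzg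
  have hwπ : ηm ^ 2 * F.piW ρ n z ≤ K₀ * F.piW ρ (n + 2) w := by
    have : ηm ^ 2 * F.piW ρ n z ≤ ηm ^ 2 * (K₀ * F.piW ρ n g) := by gcongr
    have h4 : K₀ * (ηm ^ 2 * F.piW ρ n g) ≤ K₀ * F.piW ρ (n + 2) w := by gcongr
    linarith
  have hwC : C n z ≤ Kv ^ 2 * Kh * C (n + 2) w := by
    have : Kh * C n g ≤ Kh * (Kv ^ 2 * C (n + 2) w) := by gcongr
    linarith
  have hA'r : F.piW ρ n z ≤ A' * r := by
    have h3 : diamWith θ (Metric.ball w (2 * a ^ (-((n + 2 : ℕ) : ℤ)))) ≤ 2 * r := by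
      apply Real.sSup_le _ (by linarith)
      have hin : ∀ u ∈ Metric.ball w (2 * a ^ (-((n + 2 : ℕ) : ℤ))), θ x u < r := by
        intro u hu
        apply hballs
        rw [Metric.mem_ball] at hu ⊢
        have := dist_triangle_right u x w
        linarith
      rintro _ ⟨u, hu, v, hv, rfl⟩
      have h4 := hθt u x v
      rw [hθs u x] at h4
      linarith [hin u hu, hin v hv]
    have h4 := (hKd (n + 2) w hwN).1.trans h3
    rw [inv_mul_le_iff₀ (by linarith)] at h4
    rw [hA', div_mul_eq_mul_div, le_div_iff₀ (by positivity)]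
    have : K₀ * F.piW ρ (n + 2) w ≤ K₀ * (K * (2 * r)) := by gcongr
    linarith
  have hπz := hpi n z hz
  have hCz := hC n z hz
  have hrC : 0 < r ^ β * C n z := by positivity
  constructor
  · -- lower bound
    refine le_trans ?_ (measure_mono hballs)
    have hss : s = 2 * (s / 2) := by ring
    rw [hss]
    apply mu_lower μ x (by linarith : 0 < s / 2)
    have hstep : (1 + L⁻¹ + U)⁻¹ * (r ^ β * C n z) ≤
        K₂⁻¹ * (F.piW ρ (n + 2) w ^ β * C (n + 2) w) := by
      have h3 : (1 + L⁻¹ + U)⁻¹ ≤ L := by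
        have := inv_pos.2 hL0
        rw [inv_le_comm₀ (by positivity) hL0]
        linarith
      have h4 : ηm ^ 2 / (K₀ * A) * r ≤ F.piW ρ (n + 2) w := by
        rw [div_mul_eq_mul_div, div_le_iff₀ (by positivity)]
        have : ηm ^ 2 * r ≤ ηm ^ 2 * (A * F.piW ρ n z) := by gcongr
        have h5 : A * (ηm ^ 2 * F.piW ρ n z) ≤ A * (K₀ * F.piW ρ (n + 2) w) := by gcongr
        linarith
      have h5 : (1 / (Kv ^ 2 * Kh)) * C n z ≤ C (n + 2) w := by
        rw [div_mul_eq_mul_div, div_le_iff₀ (by positivity)]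
        linarith
      calc (1 + L⁻¹ + U)⁻¹ * (r ^ β * C n z) ≤ L * (r ^ β * C n z) := by gcongr
        _ = K₂⁻¹ * ((ηm ^ 2 / (K₀ * A) * r) ^ β * ((1 / (Kv ^ 2 * Kh)) * C n z)) := by
            rw [hL, Real.mul_rpow (by positivity) hr.le]; ring
        _ ≤ _ := by
            have h6 := hpi (n + 2) w hwN
            gcongr
    refine hstep.trans ?_
    apply hlow _ _ (n + 2) (bump_cont _ _)
    intro k hk
    refine (hdesc (n + 2) w hwN k hk).1.trans ?_
    refine le_trans ?_ (Finset.sum_le_sum_of_subset_of_nonneg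
      (Finset.filter_subset (fun y => F.anc (k - (n + 2)) k y = w) (F.N k))
      (fun y hy _ => mul_nonneg (hw k y hy).le (bump_nonneg _ _ _)))
    apply Finset.sum_le_sum
    intro y hy
    rw [Finset.mem_filter] at hy
    obtain ⟨-, hyd⟩ := anc_mem_dist F ha2 k y hy.1 (k - (n + 2)) (by omega)
    rw [hy.2, show k - (k - (n + 2)) = n + 2 by omega] at hyd
    rw [bump_eq_one (by linarith), mul_one]
    have := dist_triangle_right x y w
    linarith
  · -- upper bound
    obtain ⟨m, hm⟩ : ∃ m, m = n - l := ⟨_, rfl⟩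
    have hEm := hE0 m
    have hsub : mball θ x r ⊆ Metric.ball x (a ^ (-(m : ℤ))) := by
      intro y hy
      rw [Metric.mem_ball, dist_comm]
      rcases Nat.eq_zero_or_pos m with h0 | h0
      · rw [h0]
        simp only [Nat.cast_zero, neg_zero, zpow_zero]
        linarith [hdist x y]
      · obtain ⟨y', hy', hry'⟩ := hout (by omega)
        have hEm2 : a ^ (-(m : ℤ)) = a ^ l * a ^ (-(n : ℤ)) := by
          rw [← zpow_natCast, ← zpow_add₀ ha0.ne']
          congr 1
          omega
        by_cases hxy : x = y
        · rw [hxy, dist_self]; exact hEm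
        have hxy0 : 0 < dist x y := dist_pos.2 hxy
        have h3 := hqs x y' y hxy
        have h4 : θ x y < r := hy
        have h5 : c < dist x y' / dist x y := by
          by_contra hcon
          rw [not_lt] at hcon
          have h6 : η (dist x y' / dist x y) ≤ η c :=
            hηmono' (div_nonneg dist_nonneg dist_nonneg) hc.le hcon
          rw [hηc] at h6
          have h7 := mul_le_mul_of_nonneg_right h6 (hθ0 x y)
          simp only at h3
          linarith
        rw [lt_div_iff₀ hxy0] at h5
        rw [hEm2]
        rw [div_lt_iff₀ hc] at hl
        have hEn := hE0 n
        have h6 : 4 * a ^ (-(n : ℤ)) < (a ^ l * c) * a ^ (-(n : ℤ)) := by gcongr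
        have h7 : c * dist x y < c * (a ^ l * a ^ (-(n : ℤ))) := by linarith
        exact lt_of_mul_lt_mul_left h7 hc.le
    refine (measure_mono hsub).trans ?_
    apply mu_upper μ x hEm
    apply hupp _ _ m (bump_cont _ _)
    intro k hk
    -- the ancestor of z at level m
    obtain ⟨j, hj⟩ : ∃ j, j = n - m := ⟨_, rfl⟩
    have hnj : n - j = m := by omega
    have hjl : j ≤ l := by omega
    obtain ⟨hz'N, hz'd⟩ := anc_mem_dist F ha2 n z hz j (by omega)
    obtain ⟨hz'π, hz'C⟩ := anc_est F hηm hηρ hKv ha2 hpi hCv n z hz j (by omega)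
    rw [hnj] at hz'N hz'd hz'π hz'C
    obtain ⟨z', hz'⟩ : ∃ z', z' = F.anc j n z := ⟨_, rfl⟩
    rw [← hz'] at hz'N hz'd hz'π hz'C
    have hπz' := hpi m z' hz'N
    have hGw : ∀ g' ∈ (F.N m).filter (fun g' => g' ∈ Metric.ball x (6 * a ^ (-(m : ℤ)))),
        F.piW ρ m g' ^ β * C m g' ≤
          (K₀ * (A' / ηm ^ l)) ^ β * (Kh * Kv ^ l) * (r ^ β * C n z) := by
      intro g' hg'
      rw [Finset.mem_filter, Metric.mem_ball] at hg'
      have hd : dist g' z' < 20 * a ^ (-(m : ℤ)) := by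
        have h3 := dist_triangle4 g' x z z'
        have h4 := hEle m n (by omega)
        rw [dist_comm z x] at hzx
        linarith [hg'.2]
      obtain ⟨h3, h4⟩ := hhor m g' z' hg'.1 hz'N hd
      have h5 : F.piW ρ m z' ≤ A' / ηm ^ l * r := by
        rw [div_mul_eq_mul_div, le_div_iff₀ (by positivity)]
        have : ηm ^ l ≤ ηm ^ j := pow_le_pow_of_le_one hηm.le hηm1.le hjl
        have h6 : F.piW ρ m z' * ηm ^ l ≤ F.piW ρ m z' * ηm ^ j := by gcongr
        linarith
      have h6 : C m z' ≤ Kv ^ l * C n z := by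
        refine hz'C.trans ?_
        gcongr
      have h7 : F.piW ρ m g' ≤ K₀ * (A' / ηm ^ l) * r := by
        refine h3.trans ?_
        rw [mul_assoc]
        gcongr
      have h8 : C m g' ≤ Kh * Kv ^ l * C n z := by
        refine h4.trans ?_
        rw [mul_assoc]
        gcongr
      have h9 := hpi m g' hg'.1
      have h10 := hC m g' hg'.1
      calc F.piW ρ m g' ^ β * C m g' ≤
          (K₀ * (A' / ηm ^ l) * r) ^ β * (Kh * Kv ^ l * C n z) := by gcongr
        _ = _ := by rw [Real.mul_rpow (by positivity) hr.le]; ring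
    have hcard : ((((F.N m).filter
        (fun g' => g' ∈ Metric.ball x (6 * a ^ (-(m : ℤ))))).card : ℕ) : ℝ) ≤ KD ^ 4 := by
      apply card_sep hKD hdoub (δ := a ^ (-(m : ℤ))) 4 _ x (6 * a ^ (-(m : ℤ))) (by positivity)
      · linarith
      · intro u hu v hv
        exact F.sep m u (Finset.mem_filter.1 hu).1 v (Finset.mem_filter.1 hv).1
      · intro u hu
        exact (Finset.mem_filter.1 hu).2
    have hmaps : ∀ y ∈ (F.N k).filter (fun y => dist x y < 2 * a ^ (-(m : ℤ))),
        F.anc (k - m) k y ∈ (F.N m).filter (fun g' => g' ∈ Metric.ball x (6 * a ^ (-(m : ℤ)))) := by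
      intro y hy
      rw [Finset.mem_filter] at hy
      obtain ⟨h3, h4⟩ := anc_mem_dist F ha2 k y hy.1 (k - m) (by omega)
      rw [show k - (k - m) = m by omega] at h3 h4
      rw [Finset.mem_filter, Metric.mem_ball, dist_comm]
      refine ⟨h3, ?_⟩
      have := dist_triangle x y (F.anc (k - m) k y)
      linarith [hy.2]
    calc ∑ y ∈ F.N k, F.piW ρ k y ^ β * C k y * bump x (a ^ (-(m : ℤ))) y
        ≤ ∑ y ∈ F.N k, if dist x y < 2 * a ^ (-(m : ℤ)) then F.piW ρ k y ^ β * C k y else 0 := by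
          apply Finset.sum_le_sum
          intro y hy
          split_ifs with hd
          · exact mul_le_of_le_one_right (hw k y hy).le (bump_le_one _ _ _)
          · rw [bump_eq_zero hEm (not_lt.1 hd), mul_zero]
      _ = ∑ y ∈ (F.N k).filter (fun y => dist x y < 2 * a ^ (-(m : ℤ))),
            F.piW ρ k y ^ β * C k y := (Finset.sum_filter _ _).symm
      _ = ∑ g' ∈ (F.N m).filter (fun g' => g' ∈ Metric.ball x (6 * a ^ (-(m : ℤ)))),
            ∑ y ∈ ((F.N k).filter (fun y => dist x y < 2 * a ^ (-(m : ℤ)))).filter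
              (fun y => F.anc (k - m) k y = g'), F.piW ρ k y ^ β * C k y :=
          (Finset.sum_fiberwise_of_maps_to hmaps _).symm
      _ ≤ ∑ g' ∈ (F.N m).filter (fun g' => g' ∈ Metric.ball x (6 * a ^ (-(m : ℤ)))),
            K₂ * ((K₀ * (A' / ηm ^ l)) ^ β * (Kh * Kv ^ l) * (r ^ β * C n z)) := by
          apply Finset.sum_le_sum
          intro g' hg'
          have h3 := hGw g' hg'
          have h4 := (hdesc m g' (Finset.mem_filter.1 hg').1 k hk).2
          refine le_trans ?_ (h4.trans (by gcongr))
          apply Finset.sum_le_sum_of_subset_of_nonneg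
          · exact Finset.filter_subset_filter _ (Finset.filter_subset _ _)
          · intro y hy _
            exact (hw k y (Finset.mem_filter.1 hy).1).le
      _ ≤ KD ^ 4 * (K₂ * ((K₀ * (A' / ηm ^ l)) ^ β * (Kh * Kv ^ l) * (r ^ β * C n z))) := by
          rw [Finset.sum_const, nsmul_eq_mul]
          gcongr
      _ = U * (r ^ β * C n z) := by rw [hU]; ring
      _ ≤ (1 + L⁻¹ + U) * (r ^ β * C n z) := by
          have := inv_pos.2 hL0
          gcongr
          linarith
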